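/- (Theorem 1, two-arm binary case with fixed control rate) Let a₁, b₁, a₀, b₀ > 0, let n ≥ 1 be a natural number, let ȳ₀ ∈ (0,1), and let θ* ∈ ℝ. Then the map e ↦ ∬_{{(θ₁,θ₀) ∈ (0,1)² : θ₁ - θ₀ ≤ θ*}} f_Beta(θ₁; a₁+n(ȳ₀+e), b₁+n(1-ȳ₀-e)) · f_Beta(θ₀; a₀+nȳ₀, b₀+n(1-ȳ₀)) dθ₁ dθ₀ is antitone in e on (0, 1-ȳ₀): larger evidence e yields a smaller (or equal) value of this double integral. -/

import Mathlib

open Real MeasureTheory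

/-- The Beta function `B(a,b) = ∫₀¹ t^(a-1) (1-t)^(b-1) dt`. -/
noncomputable def betaFn (a b : ℝ) : ℝ :=
  ∫ t in (0:ℝ)..1, t ^ (a - 1) * (1 - t) ^ (b - 1)

/-- The Beta density `f_Beta(t; a, b) = t^(a-1)(1-t)^(b-1) / B(a,b)`. -/
noncomputable def betaPDF (t a b : ℝ) : ℝ :=
  t ^ (a - 1) * (1 - t) ^ (b - 1) / betaFn a b

lemma beta_kernel_intervalIntegrable {a b : ℝ} (ha : 0 < a) (hb : 0 < b) :
    IntervalIntegrable (fun t : ℝ => t ^ (a - 1) * (1 - t) ^ (b - 1)) volume 0 1 := by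
  have h := Complex.betaIntegral_convergent (u := (a : ℂ)) (v := (b : ℂ)) (by simpa) (by simpa)
  have h2 := h.norm
  rw [intervalIntegrable_iff_integrableOn_Ioo_of_le zero_le_one] at h2 ⊢
  refine h2.congr_fun ?_ measurableSet_Ioo
  intro t ht
  have h1 : 0 < 1 - t := by linarith [ht.2]
  have e1 : (1 : ℂ) - (t : ℂ) = ((1 - t : ℝ) : ℂ) := by push_cast; rfl
  simp only [norm_mul]
  rw [e1, Complex.norm_cpow_eq_rpow_re_of_pos ht.1, Complex.norm_cpow_eq_rpow_re_of_pos h1]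
  simp

lemma betaFn_pos' {a b : ℝ} (ha : 0 < a) (hb : 0 < b) : 0 < betaFn a b := by
  apply intervalIntegral.intervalIntegral_pos_of_pos_on (beta_kernel_intervalIntegrable ha hb)
  · intro t ht
    have h1 : 0 < 1 - t := by linarith [ht.2]
    have := ht.1
    positivity
  · exact zero_lt_one

lemma betaPDF_integrableOn {a b : ℝ} (ha : 0 < a) (hb : 0 < b) :
    IntegrableOn (fun t => betaPDF t a b) (Set.Ioo 0 1) := by
  have h := beta_kernel_intervalIntegrable ha hb
  rw [intervalIntegrable_iff_integrableOn_Ioo_of_le zero_le_one] at h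
  exact h.div_const _

lemma betaPDF_integral {a b : ℝ} (ha : 0 < a) (hb : 0 < b) :
    ∫ t in Set.Ioo (0:ℝ) 1, betaPDF t a b = 1 := by
  simp only [betaPDF]
  rw [integral_div, ← integral_Ioc_eq_integral_Ioo, ← intervalIntegral.integral_of_le zero_le_one]
  exact div_self (betaFn_pos' ha hb).ne'

lemma betaPDF_pos' {a b t : ℝ} (ha : 0 < a) (hb : 0 < b) (ht : t ∈ Set.Ioo (0:ℝ) 1) :
    0 < betaPDF t a b := by
  have h1 : 0 < 1 - t := by linarith [ht.2]
  have := ht.1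
  have := betaFn_pos' ha hb
  unfold betaPDF
  positivity

lemma betaPDF_shift {a b d t : ℝ} (ha : 0 < a) (hb : 0 < b - d) (hd : 0 ≤ d)
    (ht : t ∈ Set.Ioo (0:ℝ) 1) :
    betaPDF t (a + d) (b - d) =
      (t / (1 - t)) ^ d * (betaFn a b / betaFn (a + d) (b - d)) * betaPDF t a b := by
  have h1 : 0 < 1 - t := by linarith [ht.2]
  have h0 := ht.1
  have hB := (betaFn_pos' ha (show 0 < b by linarith)).ne'
  have hB' := (betaFn_pos' (show 0 < a + d by linarith) hb).ne'
  unfold betaPDF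
  rw [show a + d - 1 = (a - 1) + d by ring, show b - d - 1 = (b - 1) - d by ring,
    rpow_add h0, rpow_sub h1, div_rpow h0.le h1.le]
  have := (rpow_pos_of_pos h1 d).ne'
  field_simp

lemma betaPDF_cross {a b d s t : ℝ} (ha : 0 < a) (hb : 0 < b - d) (hd : 0 ≤ d)
    (ht : t ∈ Set.Ioo (0:ℝ) 1) (hs : s ∈ Set.Ioo (0:ℝ) 1) (hts : t ≤ s)
    (h : 0 < betaPDF t (a + d) (b - d) - betaPDF t a b) :
    0 ≤ betaPDF s (a + d) (b - d) - betaPDF s a b := by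
  have hb' : 0 < b := by linarith
  have pt := betaPDF_pos' ha hb' ht
  have ps := betaPDF_pos' ha hb' hs
  have hB := betaFn_pos' ha hb'
  have hB' := betaFn_pos' (show 0 < a + d by linarith) hb
  rw [betaPDF_shift ha hb hd ht] at h
  rw [betaPDF_shift ha hb hd hs]
  have t1 : 0 < 1 - t := by linarith [ht.2]
  have s1 : 0 < 1 - s := by linarith [hs.2]
  have t0 := ht.1
  have s0 := hs.1
  have hm : (t / (1 - t)) ^ d * (betaFn a b / betaFn (a + d) (b - d)) ≤
      (s / (1 - s)) ^ d * (betaFn a b / betaFn (a + d) (b - d)) := by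
    gcongr
  have hk : 1 < (t / (1 - t)) ^ d * (betaFn a b / betaFn (a + d) (b - d)) := by
    by_contra hc
    push Not at hc
    nlinarith
  nlinarith

lemma beta_cdf_diff {a b d : ℝ} (ha : 0 < a) (hb : 0 < b - d) (hd : 0 ≤ d) (x : ℝ) :
    ∫ t in Set.Ioo (0:ℝ) 1 ∩ Set.Iic x, (betaPDF t (a + d) (b - d) - betaPDF t a b) ≤ 0 := by
  have hb' : 0 < b := by linarith
  have i1 := betaPDF_integrableOn ha hb'
  have i2 := betaPDF_integrableOn (show 0 < a + d by linarith) hb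
  by_cases hc : ∀ t ∈ Set.Ioo (0:ℝ) 1, t ≤ x → betaPDF t (a + d) (b - d) - betaPDF t a b ≤ 0
  · apply setIntegral_nonpos (measurableSet_Ioo.inter measurableSet_Iic)
    intro t ht
    exact hc t ht.1 ht.2
  · push Not at hc
    obtain ⟨t, ht, htx, hpos⟩ := hc
    have htot : ∫ t in Set.Ioo (0:ℝ) 1, (betaPDF t (a + d) (b - d) - betaPDF t a b) = 0 := by
      rw [integral_sub i2 i1, betaPDF_integral ha hb', betaPDF_integral (by linarith) hb, sub_self]
    have hsplit := integral_inter_add_sdiff (s := Set.Ioo (0:ℝ) 1) (t := Set.Iic x)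
      measurableSet_Iic (i2.sub i1)
    have hnn : 0 ≤ ∫ t in Set.Ioo (0:ℝ) 1 \ Set.Iic x,
        (betaPDF t (a + d) (b - d) - betaPDF t a b) := by
      apply setIntegral_nonneg (measurableSet_Ioo.diff measurableSet_Iic)
      intro s hs
      have : x < s := not_le.1 hs.2
      exact betaPDF_cross ha hb hd ht hs.1 (by linarith) hpos
    simp only [Pi.sub_apply] at hsplit
    linarith

lemma prod_step {w g : ℝ → ℝ} (θs : ℝ) (hw : IntegrableOn w (Set.Ioo 0 1))
    (hg : IntegrableOn g (Set.Ioo 0 1)) (hg0 : ∀ y ∈ Set.Ioo (0:ℝ) 1, 0 ≤ g y)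
    (hcdf : ∀ x, ∫ t in Set.Ioo (0:ℝ) 1 ∩ Set.Iic x, w t ≤ 0) :
    ∫ p in {p : ℝ × ℝ | p.1 ∈ Set.Ioo (0:ℝ) 1 ∧ p.2 ∈ Set.Ioo (0:ℝ) 1 ∧ p.1 - p.2 ≤ θs},
      w p.1 * g p.2 ≤ 0 := by
  set S := {p : ℝ × ℝ | p.1 ∈ Set.Ioo (0:ℝ) 1 ∧ p.2 ∈ Set.Ioo (0:ℝ) 1 ∧ p.1 - p.2 ≤ θs} with hS
  have hSm : MeasurableSet S :=
    (measurable_fst measurableSet_Ioo).inter ((measurable_snd measurableSet_Ioo).inter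
      (measurableSet_le (measurable_fst.sub measurable_snd) measurable_const))
  have hI : IntegrableOn (fun p : ℝ × ℝ => w p.1 * g p.2) S := by
    have h := Integrable.mul_prod hw hg
    rw [Measure.prod_restrict] at h
    exact IntegrableOn.mono_set h (fun p hp => ⟨hp.1, hp.2.1⟩)
  rw [← integral_indicator hSm]
  have hI' := hI.integrable_indicator hSm
  rw [Measure.volume_eq_prod] at hI' ⊢
  rw [integral_prod_symm _ hI']
  apply integral_nonpos
  intro y
  by_cases hy : y ∈ Set.Ioo (0:ℝ) 1
  · have : (fun x => S.indicator (fun p : ℝ × ℝ => w p.1 * g p.2) (x, y)) =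
        (Set.Ioo (0:ℝ) 1 ∩ Set.Iic (θs + y)).indicator (fun x => w x * g y) := by
      funext x
      have : (x, y) ∈ S ↔ x ∈ Set.Ioo (0:ℝ) 1 ∩ Set.Iic (θs + y) := by
        simp only [hS, Set.mem_setOf_eq, hy, true_and, Set.mem_inter_iff, Set.mem_Iic,
          sub_le_iff_le_add]
      by_cases hx : (x, y) ∈ S
      · rw [Set.indicator_of_mem hx, Set.indicator_of_mem (this.1 hx)]
      · rw [Set.indicator_of_notMem hx, Set.indicator_of_notMem (fun h => hx (this.2 h))]
    simp only [this, Pi.zero_apply]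
    rw [integral_indicator (measurableSet_Ioo.inter measurableSet_Iic), integral_mul_const]
    exact mul_nonpos_of_nonpos_of_nonneg (hcdf _) (hg0 y hy)
  · have : ∀ x, S.indicator (fun p : ℝ × ℝ => w p.1 * g p.2) (x, y) = 0 := fun x =>
      Set.indicator_of_notMem (fun h => hy h.2.1) _
    simp [this]

lemma prod_integrable {w g : ℝ → ℝ} (θs : ℝ) (hw : IntegrableOn w (Set.Ioo 0 1))
    (hg : IntegrableOn g (Set.Ioo 0 1)) :
    IntegrableOn (fun p : ℝ × ℝ => w p.1 * g p.2)
      {p : ℝ × ℝ | p.1 ∈ Set.Ioo (0:ℝ) 1 ∧ p.2 ∈ Set.Ioo (0:ℝ) 1 ∧ p.1 - p.2 ≤ θs} := by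
  have h := Integrable.mul_prod hw hg
  rw [Measure.prod_restrict] at h
  exact IntegrableOn.mono_set h (fun p hp => ⟨hp.1, hp.2.1⟩)

/-- (Theorem 1, two-arm binary case with fixed control rate) The double integral
of the product of the two posterior Beta densities over `{θ₁ - θ₀ ≤ θ*}` is
antitone in the evidence `e` on `(0, 1 - ȳ₀)`. -/
theorem twoArm_binary_antitone_in_evidence (a₁ b₁ a₀ b₀ : ℝ)
    (ha₁ : 0 < a₁) (hb₁ : 0 < b₁) (ha₀ : 0 < a₀) (hb₀ : 0 < b₀)
    (n : ℕ) (hn : 1 ≤ n) (y₀ : ℝ) (hy₀ : 0 < y₀) (hy₁ : y₀ < 1) (θs : ℝ) :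
    AntitoneOn (fun e : ℝ =>
      ∫ p in {p : ℝ × ℝ | p.1 ∈ Set.Ioo (0:ℝ) 1 ∧ p.2 ∈ Set.Ioo (0:ℝ) 1 ∧ p.1 - p.2 ≤ θs},
        betaPDF p.1 (a₁ + (n : ℝ) * (y₀ + e)) (b₁ + (n : ℝ) * (1 - y₀ - e)) *
          betaPDF p.2 (a₀ + (n : ℝ) * y₀) (b₀ + (n : ℝ) * (1 - y₀)))
      (Set.Ioo 0 (1 - y₀)) := by
  intro e he e' he' hee
  have hn0 : (0:ℝ) ≤ n := Nat.cast_nonneg n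
  have hA : 0 < a₁ + (n : ℝ) * (y₀ + e) := by
    have : 0 ≤ (n : ℝ) * (y₀ + e) := mul_nonneg hn0 (by linarith [he.1])
    linarith
  have hd : 0 ≤ (n : ℝ) * (e' - e) := mul_nonneg hn0 (by linarith)
  have hB' : 0 < b₁ + (n : ℝ) * (1 - y₀ - e) - (n : ℝ) * (e' - e) := by
    have : 0 ≤ (n : ℝ) * (1 - y₀ - e') := mul_nonneg hn0 (by linarith [he'.2])
    nlinarith
  have hA0 : 0 < a₀ + (n : ℝ) * y₀ := by positivity
  have hB0 : 0 < b₀ + (n : ℝ) * (1 - y₀) := by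
    have : 0 ≤ (n : ℝ) * (1 - y₀) := mul_nonneg hn0 (by linarith)
    linarith
  have hBe : 0 < b₁ + (n : ℝ) * (1 - y₀ - e) := by linarith
  have eA : a₁ + (n : ℝ) * (y₀ + e') = a₁ + (n : ℝ) * (y₀ + e) + (n : ℝ) * (e' - e) := by ring
  have eB : b₁ + (n : ℝ) * (1 - y₀ - e') =
      b₁ + (n : ℝ) * (1 - y₀ - e) - (n : ℝ) * (e' - e) := by ring
  have i1 := betaPDF_integrableOn hA hBe
  have i2 := betaPDF_integrableOn (add_pos_of_pos_of_nonneg hA hd) hB'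
  have ig := betaPDF_integrableOn hA0 hB0
  have key := prod_step θs (i2.sub i1) ig (fun y hy => (betaPDF_pos' hA0 hB0 hy).le)
    (beta_cdf_diff hA hB' hd)
  simp only [Pi.sub_apply, sub_mul] at key
  rw [integral_sub (prod_integrable θs i2 ig) (prod_integrable θs i1 ig)] at key
  simp only [eA, eB]
  linarith
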